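/- Let n ≥ 2, let d_1 = (d_{11},p_1) ∈ ℚ² and d_i (2 ≤ i ≤ n−1) be rational data, and assume the rings R^{D}_{h_n}, R^{D}_{\tilde h_j} (n ≤ j ≤ 2n−2) are Artinian. Then: (b) multiplication by x_1+x_n induces a well-defined injective ℝ-linear map R^{D}_{h_n} → R^{D}_{\tilde h_n}, whose cokernel is isomorphic to a ring R^{D'_{(n−1)}}(n−1) in the variables x_2,…,x_n for some rational data D'_{(n−1)}; and (c) for each n+1 ≤ j ≤ 2n−2, multiplication by x_1+x_{2n−j} induces a well-defined injective ℝ-linear map R^{D}_{\tilde h_{j−1}} → R^{D}_{\tilde h_j}, whose cokernel is isomorphic to a ring R^{D'_{(n−1)}}(2n−j−1) in the variables x_2,…,x_n for some rational data D'_{(n−1)}. -/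

import Mathlib

open MvPolynomial

noncomputable section

/-- The variable `x_k` (1-indexed) of `ℝ[x_1,…,x_n]`. -/
def xv (n : ℕ) (k : ℕ) : MvPolynomial (Fin n) ℝ :=
  if h : 1 ≤ k ∧ k ≤ n then X ⟨k - 1, by omega⟩ else 0

/-- `f^{d_i}_{i,2n−1−i} = Σ_{k=1}^{i} d_{ik}·(x_k²−x_{i+1}²)···(x_k²−x_n²)
 + (−1)^{n−i+1}·p_i·x_{i+1}²···x_n²` for `i ≥ 1`, with `f^{d_0}_{0,2n−1} = x_1²···x_n²`. -/
def fDd (n : ℕ) (d : ℕ → ℕ → ℚ) (p : ℕ → ℚ) (i : ℕ) : MvPolynomial (Fin n) ℝ :=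
  if i = 0 then ∏ ℓ ∈ Finset.Icc 1 n, xv n ℓ ^ 2
  else
    (∑ k ∈ Finset.Icc 1 i,
        (d i k : ℝ) • ∏ ℓ ∈ Finset.Icc (i + 1) n, (xv n k ^ 2 - xv n ℓ ^ 2)) +
      ((-1 : ℝ) ^ (n - i + 1) * (p i : ℝ)) • ∏ ℓ ∈ Finset.Icc (i + 1) n, xv n ℓ ^ 2

/-- The polynomial `f^{d_1}_{1,j}` for `1 ≤ j ≤ 2n−2`. -/
def fD1 (n : ℕ) (d11 p1 : ℚ) (j : ℕ) : MvPolynomial (Fin n) ℝ :=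
  if j ≤ n - 2 then
    (d11 : ℝ) • ((∏ ℓ ∈ Finset.Icc 2 j, (xv n 1 - xv n ℓ)) * xv n 1)
  else if j = n - 1 then
    (d11 : ℝ) • ((∏ ℓ ∈ Finset.Icc 2 (n - 1), (xv n 1 - xv n ℓ)) * (xv n 1 + xv n n)) +
      ((-1 : ℝ) ^ (n - 1) * (p1 : ℝ)) • ∏ ℓ ∈ Finset.Icc 2 n, xv n ℓ
  else
    (d11 : ℝ) • ((∏ ℓ ∈ Finset.Icc 2 (n - 1 - (j - n)), (xv n 1 - xv n ℓ)) *
        ∏ t ∈ Finset.Icc (n - (j - n)) n, (xv n 1 ^ 2 - xv n t ^ 2)) +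
      ((-1 : ℝ) ^ n * (p1 : ℝ)) • ((∏ ℓ ∈ Finset.Icc 2 (n - 1 - (j - n)), xv n ℓ) *
        ∏ t ∈ Finset.Icc (n - (j - n)) n, xv n t ^ 2)

/-- The polynomial `f^{d_1}_{n,2n−2} = d_{11}(x_1−x_2)···(x_1−x_n) + (−1)^n·p_1·x_2···x_n`. -/
def fDnLast (n : ℕ) (d11 p1 : ℚ) : MvPolynomial (Fin n) ℝ :=
  (d11 : ℝ) • (∏ ℓ ∈ Finset.Icc 2 n, (xv n 1 - xv n ℓ)) +
    ((-1 : ℝ) ^ n * (p1 : ℝ)) • ∏ ℓ ∈ Finset.Icc 2 n, xv n ℓ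

/-- The defining ideal of `R^{D}_{h_j}` (`1 ≤ j ≤ n`): generated by `f^{d_1}_{1,j}`, the
`f^{d_i}_{i,2n−1−i}` for `2 ≤ i ≤ n−1`, and `f^{d_1}_{n,2n−2}`. -/
def IDhj (n : ℕ) (d11 p1 : ℚ) (d : ℕ → ℕ → ℚ) (p : ℕ → ℚ) (j : ℕ) :
    Ideal (MvPolynomial (Fin n) ℝ) :=
  Ideal.span
    ({fD1 n d11 p1 j, fDnLast n d11 p1} ∪ (fun i => fDd n d p i) '' Set.Icc 2 (n - 1))

/-- The defining ideal of `R^{D}_{h̃_j}` (`n ≤ j ≤ 2n−2`): generated by `f^{d_1}_{1,j}`,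
the `f^{d_i}_{i,2n−1−i}` for `2 ≤ i ≤ n−1`, and `x_1···x_n`. -/
def IDthj (n : ℕ) (d11 p1 : ℚ) (d : ℕ → ℕ → ℚ) (p : ℕ → ℚ) (j : ℕ) :
    Ideal (MvPolynomial (Fin n) ℝ) :=
  Ideal.span
    ({fD1 n d11 p1 j, ∏ ℓ ∈ Finset.Icc 1 n, xv n ℓ} ∪
      (fun i => fDd n d p i) '' Set.Icc 2 (n - 1))

/-- The defining ideal of `R^{D'_{(m)}}(s)` in `m` variables: generated by the
`f^{d'_i}_{i,2m−1−i}` for `1 ≤ i ≤ m−1` together with the product of all `m` variables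
times the `s`-th one. -/
def IDnj' (m : ℕ) (d : ℕ → ℕ → ℚ) (p : ℕ → ℚ) (s : ℕ) : Ideal (MvPolynomial (Fin m) ℝ) :=
  Ideal.span
    (insert ((∏ ℓ ∈ Finset.Icc 1 m, xv m ℓ) * xv m s)
      ((fun i => fDd m d p i) '' Set.Icc 1 (m - 1)))

/-- `f` is a nonzerodivisor on `R ⧸ J`. -/
def NzdMod {R : Type*} [CommRing R] (J : Ideal R) (f : R) : Prop :=
  ∀ a, f * a ∈ J → a ∈ J

open IsLocalRing in
/-- `R ⧸ J` has a (weakly) regular sequence of length `r` in the maximal ideal. -/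
def DepthGE {R : Type*} [CommRing R] [IsLocalRing R] : ℕ → Ideal R → Prop
  | 0, _ => True
  | r + 1, J => ∃ x ∈ maximalIdeal R, NzdMod J x ∧ DepthGE r (J ⊔ Ideal.span {x})

section LocalAlgebra

open IsLocalRing

variable {R : Type*} [CommRing R]

theorem mem_sup_span_singleton_iff {J : Ideal R} {x a : R} :
    a ∈ J ⊔ Ideal.span {x} ↔ ∃ c, a - x * c ∈ J := by
  constructor
  · intro h
    obtain ⟨j, hj, y, hy, rfl⟩ := Submodule.mem_sup.1 h
    obtain ⟨c, rfl⟩ := Ideal.mem_span_singleton'.1 hy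
    exact ⟨c, by simpa [mul_comm] using hj⟩
  · rintro ⟨c, hc⟩
    have := Ideal.add_mem _ (Ideal.mem_sup_left (T := Ideal.span {x}) hc)
      (Ideal.mem_sup_right (S := J)
        (Ideal.mul_mem_right c _ (Ideal.mem_span_singleton_self x)))
    simpa using this

theorem NzdMod.swap_right {J : Ideal R} {x z : R} (hx : NzdMod J x)
    (hz : NzdMod (J ⊔ Ideal.span {x}) z) : NzdMod (J ⊔ Ideal.span {z}) x := by
  intro a ha
  obtain ⟨b, hb⟩ := mem_sup_span_singleton_iff.1 ha
  have hb' : z * b ∈ J ⊔ Ideal.span {x} :=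
    mem_sup_span_singleton_iff.2 ⟨a, by simpa using J.neg_mem hb⟩
  obtain ⟨c, hc⟩ := mem_sup_span_singleton_iff.1 (hz b hb')
  refine mem_sup_span_singleton_iff.2 ⟨c, hx _ ?_⟩
  have := J.add_mem hb (J.mul_mem_left z hc)
  convert this using 1
  ring

theorem isAssociatedPrime_quotient_iff [IsNoetherianRing R] {J p : Ideal R} :
    IsAssociatedPrime p (R ⧸ J) ↔ p.IsPrime ∧ ∃ u, ∀ a, a ∈ p ↔ a * u ∈ J := by
  rw [isAssociatedPrime_iff]
  refine and_congr_right fun _ => ?_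
  have key : ∀ u a : R, a ∈ Submodule.colon (⊥ : Submodule R (R ⧸ J))
      {(Ideal.Quotient.mk J u)} ↔ a * u ∈ J := by
    intro u a
    rw [Submodule.mem_colon_singleton, Submodule.mem_bot, ← Ideal.Quotient.eq_zero_iff_mem,
      map_mul]
    rfl
  constructor
  · rintro ⟨u, rfl⟩
    obtain ⟨u, rfl⟩ := Ideal.Quotient.mk_surjective u
    exact ⟨u, key u⟩
  · rintro ⟨u, hu⟩
    exact ⟨Ideal.Quotient.mk J u, Ideal.ext fun a => (hu a).trans (key u a).symm⟩

theorem exists_isAssociatedPrime_of_notMem [IsNoetherianRing R] {J : Ideal R} {u : R}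
    (hu : u ∉ J) : ∃ p, IsAssociatedPrime p (R ⧸ J) ∧ ∀ a, a * u ∈ J → a ∈ p := by
  obtain ⟨p, hp, hle⟩ := exists_le_isAssociatedPrime_of_isNoetherianRing R
    (Ideal.Quotient.mk J u) (by rwa [Ne, Ideal.Quotient.eq_zero_iff_mem])
  refine ⟨p, hp, fun a ha => hle ?_⟩
  rw [Submodule.mem_colon_singleton, Submodule.mem_bot]
  exact (map_mul (Ideal.Quotient.mk J) a u).symm.trans (Ideal.Quotient.eq_zero_iff_mem.2 ha)

variable [IsLocalRing R]

theorem DepthGE.socle_eq_bot {r : ℕ} {J : Ideal R} (h : DepthGE (r + 1) J) :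
    ∀ u, (∀ x ∈ maximalIdeal R, x * u ∈ J) → u ∈ J := by
  obtain ⟨x, hx, hxJ, -⟩ := h
  exact fun u hu => hxJ u (hu x hx)

/-- The socles of `R ⧸ (J, x)` and `R ⧸ (J, f)` vanish simultaneously for nonzerodivisors
`x`, `f` on `R ⧸ J`. -/
theorem socle_eq_bot_exchange {J : Ideal R} {x f : R} (hxm : x ∈ maximalIdeal R)
    (hx : NzdMod J x) (hf : NzdMod J f)
    (h : ∀ u, (∀ y ∈ maximalIdeal R, y * u ∈ J ⊔ Ideal.span {x}) → u ∈ J ⊔ Ideal.span {x}) :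
    ∀ u, (∀ y ∈ maximalIdeal R, y * u ∈ J ⊔ Ideal.span {f}) → u ∈ J ⊔ Ideal.span {f} := by
  intro u hu
  obtain ⟨v, hv⟩ := mem_sup_span_singleton_iff.1 (hu x hxm)
  have hv' : v ∈ J ⊔ Ideal.span {x} := by
    refine h v fun y hy => ?_
    obtain ⟨w, hw⟩ := mem_sup_span_singleton_iff.1 (hu y hy)
    refine mem_sup_span_singleton_iff.2 ⟨w, hf _ ?_⟩
    have := J.sub_mem (J.mul_mem_left x hw) (J.mul_mem_left y hv)
    convert this using 1
    ring
  obtain ⟨c, hc⟩ := mem_sup_span_singleton_iff.1 hv'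
  refine mem_sup_span_singleton_iff.2 ⟨c, hx _ ?_⟩
  have := J.add_mem hv (J.mul_mem_left f hc)
  convert this using 1
  ring

variable [IsNoetherianRing R]

theorem le_of_forall_exists_sub_mul_mem {J U : Ideal R} {x : R} (hx : x ∈ maximalIdeal R)
    (h : ∀ a ∈ U, ∃ c ∈ U, a - x * c ∈ J) : U ≤ J := by
  refine Submodule.le_of_le_smul_of_le_jacobson_bot (I := maximalIdeal R)
    (IsNoetherian.noetherian U) (IsLocalRing.jacobson_eq_maximalIdeal _ bot_ne_top).ge ?_
  intro a ha
  obtain ⟨c, hc, hac⟩ := h a ha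
  have := Submodule.add_mem_sup hac (Submodule.smul_mem_smul hx hc)
  simpa using this

theorem exists_nzdMod_of_socle_eq_bot {J K : Ideal R}
    (hJ : ∀ u, (∀ x ∈ maximalIdeal R, x * u ∈ J) → u ∈ J)
    (hK : ∀ u, (∀ x ∈ maximalIdeal R, x * u ∈ K) → u ∈ K) :
    ∃ z ∈ maximalIdeal R, NzdMod J z ∧ NzdMod K z := by
  classical
  have hfin := (associatedPrimes.finite R (R ⧸ J)).union (associatedPrimes.finite R (R ⧸ K))
  have aux : ∀ L : Ideal R, (∀ u, (∀ x ∈ maximalIdeal R, x * u ∈ L) → u ∈ L) →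
      ∀ p, IsAssociatedPrime p (R ⧸ L) → ¬ maximalIdeal R ≤ p := by
    intro L hL p hp hle
    obtain ⟨hprime, u, hu⟩ := isAssociatedPrime_quotient_iff.1 hp
    refine hprime.one_notMem ((hu 1).2 ?_)
    rw [one_mul]
    exact hL u fun x hx => (hu x).1 (hle hx)
  have hnot : ¬ ((maximalIdeal R : Set R) ⊆ ⋃ p ∈ (hfin.toFinset : Set (Ideal R)), (p : Set R)) := by
    rw [Ideal.subset_union_prime (f := fun p : Ideal R => p) ⊥ ⊥]
    · rintro ⟨p, hp, hle⟩
      rcases (hfin.mem_toFinset.1 hp) with hp | hp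
      · exact aux J hJ p hp hle
      · exact aux K hK p hp hle
    · intro p hp _ _
      rcases (hfin.mem_toFinset.1 hp) with hp | hp <;> exact hp.isPrime
  obtain ⟨z, hz, hzn⟩ := Set.not_subset.1 hnot
  simp only [Set.Finite.coe_toFinset, Set.mem_iUnion, not_exists] at hzn
  refine ⟨z, hz, fun a ha => ?_, fun a ha => ?_⟩
  · by_contra hna
    obtain ⟨p, hp, h⟩ := exists_isAssociatedPrime_of_notMem hna
    exact hzn p (Or.inl hp) (h z ha)
  · by_contra hna
    obtain ⟨p, hp, h⟩ := exists_isAssociatedPrime_of_notMem hna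
    exact hzn p (Or.inr hp) (h z ha)

theorem DepthGE.sup_span_singleton {r : ℕ} : ∀ {J : Ideal R} {f : R}, f ∈ maximalIdeal R →
    NzdMod J f → DepthGE (r + 1) J → DepthGE r (J ⊔ Ideal.span {f}) := by
  induction r with
  | zero => intros; trivial
  | succ r ih =>
    rintro J f hfm hf ⟨x, hxm, hx, hdx⟩
    obtain ⟨z, hzm, hzx, hzf⟩ := exists_nzdMod_of_socle_eq_bot hdx.socle_eq_bot
      (socle_eq_bot_exchange hxm hx hf hdx.socle_eq_bot)
    have hdxz := ih hzm hzx hdx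
    have hdz : DepthGE (r + 1) (J ⊔ Ideal.span {z}) :=
      ⟨x, hxm, hx.swap_right hzx, by rwa [sup_right_comm]⟩
    have := ih hfm (hf.swap_right hzf) hdz
    exact ⟨z, hzm, hzf, by rwa [sup_right_comm]⟩

theorem exists_isAssociatedPrime_sup_span_singleton {J p : Ideal R} {x : R}
    (hxm : x ∈ maximalIdeal R) (hx : NzdMod J x) (hp : IsAssociatedPrime p (R ⧸ J)) :
    x ∉ p ∧ ∃ q, IsAssociatedPrime q (R ⧸ (J ⊔ Ideal.span {x})) ∧ p ≤ q ∧ x ∈ q := by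
  obtain ⟨hprime, u, hu⟩ := isAssociatedPrime_quotient_iff.1 hp
  have huJ : u ∉ J := fun h => hprime.one_notMem ((hu 1).2 (by rwa [one_mul]))
  refine ⟨fun h => huJ (hx u ((hu x).1 h)), ?_⟩
  have hex : ∃ v ∈ Submodule.colon J (p : Set R), v ∉ J ⊔ Ideal.span {x} := by
    by_contra! hcon
    refine huJ (le_of_forall_exists_sub_mul_mem hxm (U := Submodule.colon J (p : Set R))
      (fun a ha => ?_) ?_)
    · obtain ⟨c, hc⟩ := mem_sup_span_singleton_iff.1 (hcon a ha)
      refine ⟨c, ?_, hc⟩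
      rw [Submodule.mem_colon] at ha ⊢
      intro y hy
      refine hx _ ?_
      have := J.sub_mem (ha y hy) (J.mul_mem_left y hc)
      convert this using 1
      simp only [smul_eq_mul]
      ring
    · rw [Submodule.mem_colon]
      intro y hy
      rw [smul_eq_mul, mul_comm]
      exact (hu y).1 hy
  obtain ⟨v, hv, hvn⟩ := hex
  obtain ⟨q, hq, hle⟩ := exists_isAssociatedPrime_of_notMem hvn
  refine ⟨q, hq, fun y hy => hle y ?_, hle x ?_⟩
  · rw [mul_comm]
    exact Ideal.mem_sup_left (Submodule.mem_colon.1 hv y hy)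
  · exact Ideal.mem_sup_right (Ideal.mul_mem_right _ _ (Ideal.mem_span_singleton_self x))

theorem DepthGE.le_ringKrullDim {r : ℕ} : ∀ {J p : Ideal R}, DepthGE r J →
    IsAssociatedPrime p (R ⧸ J) → (r : WithBot ℕ∞) ≤ ringKrullDim (R ⧸ p) := by
  induction r with
  | zero =>
    intro J p _ hp
    have := hp.isPrime
    simpa using ringKrullDim_nonneg_of_nontrivial
  | succ r ih =>
    rintro J p ⟨x, hxm, hx, hdx⟩ hp
    obtain ⟨hxp, q, hq, hpq, hxq⟩ := exists_isAssociatedPrime_sup_span_singleton hxm hx hp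
    have := hp.isPrime
    have hle := ringKrullDim_succ_le_of_surjective (Ideal.Quotient.factor hpq)
      (Ideal.Quotient.factor_surjective hpq) (r := Ideal.Quotient.mk p x)
      (mem_nonZeroDivisors_of_ne_zero (by rwa [Ne, Ideal.Quotient.eq_zero_iff_mem]))
      (by simpa [Ideal.Quotient.eq_zero_iff_mem] using hxq)
    refine le_trans ?_ hle
    push_cast
    gcongr
    exact ih hdx hq

theorem ringKrullDim_quotient_le_card {p : Ideal R} [p.IsPrime] (s : Finset R)
    (h : maximalIdeal R ≤ (p ⊔ Ideal.span (s : Set R)).radical) (hs : ∀ a ∈ s, a ∈ maximalIdeal R) :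
    ringKrullDim (R ⧸ p) ≤ s.card := by
  classical
  have : IsLocalRing (R ⧸ p) :=
    IsLocalRing.of_surjective' (Ideal.Quotient.mk p) Ideal.Quotient.mk_surjective
  rw [← IsLocalRing.maximalIdeal_height_eq_ringKrullDim]
  have hmin : maximalIdeal (R ⧸ p) ∈
      (Ideal.span ((s.image (Ideal.Quotient.mk p) : Finset (R ⧸ p)) : Set (R ⧸ p))).minimalPrimes := by
    refine ⟨⟨inferInstance, ?_⟩, ?_⟩
    · rw [Ideal.span_le]
      intro b hb
      obtain ⟨a, ha, rfl⟩ := Finset.mem_image.1 (Finset.mem_coe.1 hb)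
      have := IsLocalHom.of_surjective (Ideal.Quotient.mk p) Ideal.Quotient.mk_surjective
      exact map_nonunit (Ideal.Quotient.mk p) a (hs a ha)
    · rintro q ⟨hq, hsq⟩ _
      have hcomap : maximalIdeal R ≤ q.comap (Ideal.Quotient.mk p) := by
        refine h.trans ((Ideal.radical_mono ?_).trans (hq.comap _).radical.le)
        refine sup_le ?_ ?_
        · intro a ha
          rw [Ideal.mem_comap, Ideal.Quotient.eq_zero_iff_mem.2 ha]
          exact q.zero_mem
        · rw [Ideal.span_le]
          intro a ha
          exact hsq (Ideal.subset_span (by simpa using ⟨a, ha, rfl⟩))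
      intro b hb
      obtain ⟨a, rfl⟩ := Ideal.Quotient.mk_surjective b
      refine hcomap ?_
      rw [mem_maximalIdeal, mem_nonunits_iff] at hb ⊢
      exact fun hu => hb (hu.map _)
  have h1 := Ideal.height_le_card_of_mem_minimalPrimes_span_finset hmin
  exact_mod_cast h1.trans (by exact_mod_cast Finset.card_image_le)

theorem DepthGE.nzdMod_of_le_radical {J : Ideal R} {g : R} (l : List R)
    (hd : DepthGE (l.length + 1) J) (hl : ∀ a ∈ l, a ∈ maximalIdeal R)
    (hrad : maximalIdeal R ≤ (J ⊔ Ideal.span {a | a ∈ l} ⊔ Ideal.span {g}).radical) :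
    NzdMod J g := by
  classical
  intro u hu
  by_contra hun
  obtain ⟨p, hp, hle⟩ := exists_isAssociatedPrime_of_notMem hun
  have := hp.isPrime
  have h1 := hd.le_ringKrullDim hp
  have h2 : ringKrullDim (R ⧸ p) ≤ l.toFinset.card := by
    refine ringKrullDim_quotient_le_card _ (hrad.trans (Ideal.radical_mono ?_)) (by simpa using hl)
    refine sup_le (sup_le (fun a ha => Ideal.mem_sup_left (hle a (J.mul_mem_right u ha))) ?_) ?_
    · simp
    · rw [Ideal.span_singleton_le_iff_mem]
      exact Ideal.mem_sup_left (hle g hu)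
  have h3 : l.length + 1 ≤ l.toFinset.card := by exact_mod_cast h1.trans h2
  have := l.toFinset_card_le
  omega

/-- In a local ring of depth `l.length + 1`, if the elements of `l` together with `g` generate an
ideal primary to the maximal ideal, then `g` is a nonzerodivisor modulo `l`. -/
theorem nzdMod_sup_span_of_le_radical {g : R} (hg : g ∈ maximalIdeal R) (l : List R) :
    ∀ {J : Ideal R}, DepthGE (l.length + 1) J → (∀ a ∈ l, a ∈ maximalIdeal R) →
    maximalIdeal R ≤ (J ⊔ Ideal.span {a | a ∈ l} ⊔ Ideal.span {g}).radical →
    NzdMod (J ⊔ Ideal.span {a | a ∈ l}) g := by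
  induction l with
  | nil =>
    intro J hd hl hrad
    simpa using hd.nzdMod_of_le_radical [] hl hrad
  | cons h l ih =>
    intro J hd hl hrad
    have hspan : J ⊔ Ideal.span {a | a ∈ h :: l} =
        J ⊔ Ideal.span {h} ⊔ Ideal.span {a | a ∈ l} := by
      rw [sup_assoc, ← Ideal.span_union]
      congr 2
      ext a
      simp
    rw [hspan] at hrad ⊢
    have hnzd : NzdMod J h := by
      refine DepthGE.nzdMod_of_le_radical (g :: l) (by simpa using hd) ?_ ?_
      · intro a ha
        rcases List.mem_cons.1 ha with rfl | ha
        · exact hg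
        · exact hl a (List.mem_cons_of_mem _ ha)
      · convert hrad using 2
        have : {a | a ∈ g :: l} = {g} ∪ {a | a ∈ l} := by ext; simp
        rw [this, Ideal.span_union]
        ac_rfl
    exact ih (hd.sup_span_singleton (hl h (by simp)) hnzd)
      (fun a ha => hl a (List.mem_cons_of_mem _ ha)) hrad

end LocalAlgebra

section PolynomialRing

variable {n : ℕ}

/-- The ideal of polynomials without constant term is prime. -/
instance isPrime_ker_constantCoeff :
    (RingHom.ker (constantCoeff : MvPolynomial (Fin n) ℝ →+* ℝ)).IsPrime :=
  RingHom.ker_isPrime _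

theorem nzdMod_span_X_lt {k : ℕ} (hk : k < n) :
    NzdMod (Ideal.span ((X : Fin n → MvPolynomial (Fin n) ℝ) '' {i | i.1 < k})) (X ⟨k, hk⟩) := by
  intro a ha
  rw [mem_ideal_span_X_image] at ha ⊢
  intro m hm
  obtain ⟨i, hi, hne⟩ := ha (m + Finsupp.single ⟨k, hk⟩ 1) (by
    rw [mem_support_iff, mul_comm, coeff_mul_X]
    exact mem_support_iff.1 hm)
  refine ⟨i, hi, ?_⟩
  have hik : (⟨k, hk⟩ : Fin n) ≠ i := by
    rintro rfl
    exact lt_irrefl k hi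
  simpa [Finsupp.single_apply, hik] using hne

theorem NzdMod.map_localization {R S : Type*} [CommRing R] [CommRing S] [Algebra R S]
    (M : Submonoid R) [IsLocalization M S] {J : Ideal R} {f : R} (h : NzdMod J f) :
    NzdMod (J.map (algebraMap R S)) (algebraMap R S f) := by
  intro a ha
  obtain ⟨a, s, rfl⟩ := IsLocalization.exists_mk'_eq M a
  rw [IsLocalization.mul_mk'_eq_mk'_of_mul, IsLocalization.mk'_mem_map_algebraMap_iff] at ha
  rw [IsLocalization.mk'_mem_map_algebraMap_iff]
  obtain ⟨t, ht, hta⟩ := ha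
  exact ⟨t, ht, h _ (by rwa [mul_left_comm] at hta)⟩

open IsLocalRing in
theorem depthGE_localization_bot (A : Type*) [CommRing A] [Algebra (MvPolynomial (Fin n) ℝ) A]
    [IsLocalization.AtPrime A (RingHom.ker (constantCoeff : MvPolynomial (Fin n) ℝ →+* ℝ))]
    [IsLocalRing A] : DepthGE n (⊥ : Ideal A) := by
  have key : ∀ r k, k + r = n → DepthGE r ((Ideal.span
      ((X : Fin n → MvPolynomial (Fin n) ℝ) '' {i | i.1 < k})).map
        (algebraMap _ A)) := by
    intro r
    induction r with
    | zero => intros; trivial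
    | succ r ih =>
      intro k hk
      have hkn : k < n := by omega
      have hnzd := NzdMod.map_localization (S := A)
        (RingHom.ker (constantCoeff : MvPolynomial (Fin n) ℝ →+* ℝ)).primeCompl
        (nzdMod_span_X_lt hkn)
      refine ⟨algebraMap (MvPolynomial (Fin n) ℝ) A (X ⟨k, hkn⟩), ?_, hnzd, ?_⟩
      · rw [IsLocalization.AtPrime.to_map_mem_maximal_iff A
          (RingHom.ker (constantCoeff : MvPolynomial (Fin n) ℝ →+* ℝ))]
        simp [RingHom.mem_ker]
      · convert ih (k + 1) (by omega)
        rw [← Set.image_singleton, ← Ideal.map_span, ← Ideal.map_sup, ← Ideal.span_union]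
        congr 2
        ext p
        constructor
        · rintro (⟨i, hi, rfl⟩ | rfl)
          · exact ⟨i, Nat.lt_succ_of_lt hi, rfl⟩
          · exact ⟨_, Nat.lt_succ_self k, rfl⟩
        · rintro ⟨i, hi, rfl⟩
          rcases Nat.lt_succ_iff_lt_or_eq.1 hi with hi | hi
          · exact Or.inl ⟨i, hi, rfl⟩
          · exact Or.inr (by subst hi; rfl)
  have := key n 0 (by omega)
  simpa using this

/-- If `n - 1` polynomials without constant term together with `g` generate an ideal whose radical
contains all variables, then `g` is a nonzerodivisor modulo them locally at the origin. -/
theorem exists_mul_mem_span_of_mul_mem (l : List (MvPolynomial (Fin n) ℝ))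
    (hlen : l.length + 1 = n) (hl : ∀ a ∈ l, constantCoeff a = 0) {g : MvPolynomial (Fin n) ℝ}
    (hg : constantCoeff g = 0)
    (hrad : RingHom.ker (constantCoeff : MvPolynomial (Fin n) ℝ →+* ℝ) ≤
      (Ideal.span {a | a ∈ l} ⊔ Ideal.span {g}).radical)
    {a : MvPolynomial (Fin n) ℝ} (ha : g * a ∈ Ideal.span {a | a ∈ l}) :
    ∃ s, constantCoeff s ≠ 0 ∧ s * a ∈ Ideal.span {a | a ∈ l} := by
  set m := RingHom.ker (constantCoeff : MvPolynomial (Fin n) ℝ →+* ℝ) with hm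
  let A := Localization.AtPrime m
  let φ : MvPolynomial (Fin n) ℝ →+* A := algebraMap _ _
  have hmem : ∀ x, constantCoeff x = 0 → φ x ∈ IsLocalRing.maximalIdeal A := fun x hx =>
    (IsLocalization.AtPrime.to_map_mem_maximal_iff A m x).2 hx
  have hspan : Ideal.span {b | b ∈ l.map φ} = (Ideal.span {a | a ∈ l}).map φ := by
    rw [Ideal.map_span]
    congr 1
    ext b
    simp
  have hnzd := nzdMod_sup_span_of_le_radical (hmem g hg) (l.map φ) (J := ⊥)
    (by rw [List.length_map, hlen]; exact depthGE_localization_bot A)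
    (by
      intro b hb
      obtain ⟨a, ha, rfl⟩ := List.mem_map.1 hb
      exact hmem a (hl a ha))
    (by
      rw [bot_sup_eq, hspan, ← Set.image_singleton, ← Ideal.map_span, ← Ideal.map_sup,
        ← Localization.AtPrime.map_eq_maximalIdeal]
      exact (Ideal.map_mono hrad).trans (Ideal.map_radical_le φ))
  rw [bot_sup_eq, hspan] at hnzd
  have := hnzd (φ a) (by rw [← map_mul]; exact Ideal.mem_map_of_mem φ ha)
  rw [IsLocalization.algebraMap_mem_map_algebraMap_iff m.primeCompl] at this
  obtain ⟨s, hs, hsa⟩ := this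
  exact ⟨s, hs, hsa⟩

theorem mem_of_mul_mem_of_ker_le_radical {I : Ideal (MvPolynomial (Fin n) ℝ)}
    (hrad : RingHom.ker (constantCoeff : MvPolynomial (Fin n) ℝ →+* ℝ) ≤ I.radical)
    {s a : MvPolynomial (Fin n) ℝ} (hs : constantCoeff s ≠ 0) (h : s * a ∈ I) : a ∈ I := by
  have hmem : s - C (constantCoeff s) ∈ I.radical := hrad (by simp [RingHom.mem_ker])
  obtain ⟨N, hN⟩ := hmem
  have hdvd : s ∣ (s - C (constantCoeff s)) ^ N - (-C (constantCoeff s)) ^ N := by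
    have := sub_dvd_pow_sub_pow (s - C (constantCoeff s)) (-C (constantCoeff s)) N
    rwa [sub_neg_eq_add, sub_add_cancel] at this
  obtain ⟨b, hb⟩ := hdvd
  have hmul : (-C (constantCoeff s)) ^ N * a ∈ I := by
    have := I.sub_mem (I.mul_mem_right a hN) (I.mul_mem_left b h)
    convert this using 1
    linear_combination -a * hb
  have hunit : IsUnit ((-C (constantCoeff s) : MvPolynomial (Fin n) ℝ) ^ N) :=
    ((hs.isUnit.map C).neg).pow N
  exact (Ideal.unit_mul_mem_iff_mem I hunit).1 hmul

attribute [local instance] MvPolynomial.gradedAlgebra in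
theorem homogeneousComponent_mem_span {s : Set (MvPolynomial (Fin n) ℝ)}
    (hs : ∀ f ∈ s, ∃ k, f.IsHomogeneous k) {f : MvPolynomial (Fin n) ℝ} (hf : f ∈ Ideal.span s)
    (k : ℕ) : homogeneousComponent k f ∈ Ideal.span s := by
  have hI : (Ideal.span s).IsHomogeneous (homogeneousSubmodule (Fin n) ℝ) :=
    Ideal.homogeneous_span _ _ fun f hf => hs f hf
  have := hI k hf
  rwa [← MvPolynomial.decomposition.decompose'_apply]

theorem ker_constantCoeff_le_radical {s : Set (MvPolynomial (Fin n) ℝ)}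
    (hs : ∀ f ∈ s, ∃ k, f.IsHomogeneous k)
    [FiniteDimensional ℝ (MvPolynomial (Fin n) ℝ ⧸ Ideal.span s)] :
    RingHom.ker (constantCoeff : MvPolynomial (Fin n) ℝ →+* ℝ) ≤ (Ideal.span s).radical := by
  have hle : RingHom.ker (constantCoeff : MvPolynomial (Fin n) ℝ →+* ℝ) ≤
      Ideal.span (X '' (Set.univ : Set (Fin n))) := by
    intro f hf
    rw [mem_ideal_span_X_image]
    intro m hm
    by_contra! hcon
    have : m = 0 := Finsupp.ext fun i => hcon i (Set.mem_univ i)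
    subst this
    exact mem_support_iff.1 hm hf
  refine hle.trans (Ideal.span_le.2 ?_)
  rintro _ ⟨i, -, rfl⟩
  obtain ⟨q, hq, hqi⟩ := Algebra.IsIntegral.isIntegral (R := ℝ)
    (Ideal.Quotient.mk (Ideal.span s) (X i))
  have hmem : Polynomial.aeval (X i) q ∈ Ideal.span s := by
    rw [← Ideal.Quotient.eq_zero_iff_mem, ← Ideal.Quotient.mkₐ_eq_mk ℝ,
      ← Polynomial.aeval_algHom_apply]
    exact hqi
  refine ⟨q.natDegree, ?_⟩
  have := homogeneousComponent_mem_span hs hmem q.natDegree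
  convert this
  rw [Polynomial.aeval_eq_sum_range, map_sum, Finset.sum_eq_single q.natDegree]
  · rw [hq.coeff_natDegree, one_smul, homogeneousComponent_of_mem (isHomogeneous_X_pow i _),
      if_pos rfl]
  · intro k _ hk
    rw [map_smul, homogeneousComponent_of_mem (isHomogeneous_X_pow i _), if_neg hk.symm, smul_zero]
  · simp

end PolynomialRing

section QuotientSequence

/-- An exact sequence `0 → S ⧸ I → S ⧸ I' → S' ⧸ J → 0` whose first map is multiplication by `g`
and whose second map is induced by a surjection `θ` with kernel generated by `g`. -/
theorem exists_mul_exact_sequence {S S' : Type*} [CommRing S] [CommRing S'] [Algebra ℝ S]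
    [Algebra ℝ S'] {I I' : Ideal S} {J : Ideal S'} {g : S} (θ : S →ₐ[ℝ] S')
    (hθ : Function.Surjective θ) (hg : θ g = 0) (hker : ∀ q, θ q = 0 → q ∈ Ideal.span {g})
    (hmul : ∀ a, g * a ∈ I' ↔ a ∈ I) (hmap : I'.map θ = J) :
    ∃ (φ : (S ⧸ I) →ₗ[ℝ] (S ⧸ I')) (ψ : (S ⧸ I') →ₐ[ℝ] (S' ⧸ J)),
      (∀ f : S, φ (Ideal.Quotient.mk I f) = Ideal.Quotient.mk I' (g * f)) ∧
      Function.Injective φ ∧ Function.Surjective ψ ∧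
      LinearMap.range φ = LinearMap.ker ψ.toLinearMap := by
  subst hmap
  let φ : (S ⧸ I) →ₗ[ℝ] (S ⧸ I') :=
    (Submodule.mapQ I I' (LinearMap.mulLeft S g) fun a ha => (hmul a).2 ha).restrictScalars ℝ
  let ψ : (S ⧸ I') →ₐ[ℝ] (S' ⧸ I'.map θ) :=
    Ideal.quotientMapₐ (I'.map θ) θ Ideal.le_comap_map
  have hφ : ∀ f : S, φ (Ideal.Quotient.mk I f) = Ideal.Quotient.mk I' (g * f) := fun f => rfl
  have hψ : ∀ f : S, ψ (Ideal.Quotient.mk I' f) = Ideal.Quotient.mk (I'.map θ) (θ f) :=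
    fun f => rfl
  refine ⟨φ, ψ, hφ, ?_, ?_, ?_⟩
  · rw [injective_iff_map_eq_zero]
    intro a ha
    obtain ⟨a, rfl⟩ := Ideal.Quotient.mk_surjective a
    rw [hφ, Ideal.Quotient.eq_zero_iff_mem] at ha
    rw [Ideal.Quotient.eq_zero_iff_mem]
    exact (hmul a).1 ha
  · intro b
    obtain ⟨b, rfl⟩ := Ideal.Quotient.mk_surjective b
    obtain ⟨a, rfl⟩ := hθ b
    exact ⟨Ideal.Quotient.mk I' a, hψ a⟩
  · ext b
    obtain ⟨b, rfl⟩ := Ideal.Quotient.mk_surjective b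
    rw [LinearMap.mem_ker, AlgHom.toLinearMap_apply, hψ, Ideal.Quotient.eq_zero_iff_mem]
    constructor
    · rintro ⟨a, ha⟩
      obtain ⟨a, rfl⟩ := Ideal.Quotient.mk_surjective a
      rw [hφ, Ideal.Quotient.eq] at ha
      have := Ideal.mem_map_of_mem θ ha
      simpa [hg] using this
    · intro h
      obtain ⟨c, hc, hcb⟩ := (Ideal.mem_map_iff_of_surjective θ hθ).1 h
      obtain ⟨e, he⟩ := Ideal.mem_span_singleton'.1 (hker (b - c) (by rw [map_sub, hcb, sub_self]))
      refine ⟨Ideal.Quotient.mk I e, ?_⟩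
      rw [hφ, Ideal.Quotient.eq, mul_comm, he]
      simpa using I'.neg_mem hc

end QuotientSequence

section Generators

theorem isHomogeneous_xv (n k : ℕ) : (xv n k).IsHomogeneous 1 := by
  unfold xv
  split_ifs
  · exact isHomogeneous_X _ _
  · exact isHomogeneous_zero _ _ _

theorem isHomogeneous_prod_of_const {n k : ℕ} {s : Finset ℕ} {f : ℕ → MvPolynomial (Fin n) ℝ}
    (h : ∀ i ∈ s, (f i).IsHomogeneous k) : (∏ i ∈ s, f i).IsHomogeneous (s.card * k) := by
  have := IsHomogeneous.prod s f (fun _ => k) h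
  simpa using this

theorem isHomogeneous_real_smul {n k : ℕ} {f : MvPolynomial (Fin n) ℝ} (h : f.IsHomogeneous k)
    (c : ℝ) : (c • f).IsHomogeneous k :=
  (homogeneousSubmodule (Fin n) ℝ k).smul_mem c h

theorem isHomogeneous_fDd (n : ℕ) (d : ℕ → ℕ → ℚ) (p : ℕ → ℚ) {i : ℕ} (hi : i ≠ 0) :
    (fDd n d p i).IsHomogeneous ((n - i) * 2) := by
  have hcard : n - i = (Finset.Icc (i + 1) n).card := by simp
  rw [fDd, if_neg hi, hcard]
  refine IsHomogeneous.add (IsHomogeneous.sum _ _ _ fun k _ => ?_) ?_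
  · exact isHomogeneous_real_smul (isHomogeneous_prod_of_const fun l _ =>
      ((isHomogeneous_xv n k).pow 2).sub ((isHomogeneous_xv n l).pow 2)) _
  · exact isHomogeneous_real_smul
      (isHomogeneous_prod_of_const fun l _ => (isHomogeneous_xv n l).pow 2) _

theorem isHomogeneous_prod_xv (n : ℕ) : (∏ ℓ ∈ Finset.Icc 1 n, xv n ℓ).IsHomogeneous n := by
  simpa using isHomogeneous_prod_of_const (s := Finset.Icc 1 n) fun l _ => isHomogeneous_xv n l

/-- The common form of `f^{d_1}_{n,2n−2}` (for `t = n`) and of `f^{d_1}_{1,2n−1−t}` (for `t < n`). -/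
def fMix (n : ℕ) (d11 p1 : ℚ) (t : ℕ) : MvPolynomial (Fin n) ℝ :=
  (d11 : ℝ) • ((∏ ℓ ∈ Finset.Icc 2 t, (xv n 1 - xv n ℓ)) *
      ∏ ℓ ∈ Finset.Icc (t + 1) n, (xv n 1 ^ 2 - xv n ℓ ^ 2)) +
    ((-1 : ℝ) ^ n * (p1 : ℝ)) • ((∏ ℓ ∈ Finset.Icc 2 t, xv n ℓ) *
      ∏ ℓ ∈ Finset.Icc (t + 1) n, xv n ℓ ^ 2)

theorem isHomogeneous_fMix (n : ℕ) (d11 p1 : ℚ) (t : ℕ) :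
    (fMix n d11 p1 t).IsHomogeneous ((t - 1) + (n - t) * 2) := by
  have h1 : t - 1 = (Finset.Icc 2 t).card * 1 := by simp
  have h2 : n - t = (Finset.Icc (t + 1) n).card := by simp
  rw [fMix, h1, h2]
  refine IsHomogeneous.add ?_ ?_
  · exact isHomogeneous_real_smul ((isHomogeneous_prod_of_const fun l _ =>
      (isHomogeneous_xv n 1).sub (isHomogeneous_xv n l)).mul
      (isHomogeneous_prod_of_const fun l _ =>
        ((isHomogeneous_xv n 1).pow 2).sub ((isHomogeneous_xv n l).pow 2))) _
  · exact isHomogeneous_real_smul ((isHomogeneous_prod_of_const fun l _ => isHomogeneous_xv n l).mul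
      (isHomogeneous_prod_of_const fun l _ => (isHomogeneous_xv n l).pow 2)) _

theorem constantCoeff_eq_zero_of_isHomogeneous {n k : ℕ} {f : MvPolynomial (Fin n) ℝ}
    (h : f.IsHomogeneous k) (hk : k ≠ 0) : constantCoeff f = 0 := by
  rw [constantCoeff_eq]
  exact h.coeff_eq_zero (by simpa using hk.symm)

theorem fD1_eq_fMix {n j : ℕ} (hn : 2 ≤ n) (hj : n ≤ j) (hj' : j ≤ 2 * n - 2) (d11 p1 : ℚ) :
    fD1 n d11 p1 j = fMix n d11 p1 (2 * n - 1 - j) := by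
  have h1 : n - 1 - (j - n) = 2 * n - 1 - j := by omega
  have h2 : n - (j - n) = 2 * n - 1 - j + 1 := by omega
  rw [fD1, if_neg (by omega), if_neg (by omega), h1, h2, fMix]

theorem fDnLast_eq_fMix (n : ℕ) (d11 p1 : ℚ) : fDnLast n d11 p1 = fMix n d11 p1 n := by
  simp [fDnLast, fMix]

theorem prod_Icc_eq_mul_prod {M : Type*} [CommMonoid M] {a b : ℕ} (h : a ≤ b) (f : ℕ → M) :
    ∏ ℓ ∈ Finset.Icc a b, f ℓ = f a * ∏ ℓ ∈ Finset.Icc (a + 1) b, f ℓ := by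
  rw [← Finset.mul_prod_Ioc_eq_prod_Icc h, ← Finset.Icc_add_one_left_eq_Ioc]

theorem prod_Icc_eq_mul_prod_mul_prod {M : Type*} [CommMonoid M] {n u : ℕ} (hu : 1 ≤ u)
    (hun : u ≤ n) (f : ℕ → M) :
    ∏ ℓ ∈ Finset.Icc 1 n, f ℓ =
      f 1 * (∏ ℓ ∈ Finset.Icc 2 u, f ℓ) * ∏ ℓ ∈ Finset.Icc (u + 1) n, f ℓ := by
  rw [← prod_Icc_eq_mul_prod hu]
  simpa [← Finset.Ico_add_one_right_eq_Icc] using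
    (Finset.prod_Ico_consecutive f (m := 1) (n := u + 1) (k := n + 1) (by omega) (by omega)).symm

theorem mul_fMix {n u : ℕ} (hu : 1 ≤ u) (hun : u + 1 ≤ n) (d11 p1 : ℚ) :
    (xv n 1 + xv n (u + 1)) * fMix n d11 p1 (u + 1) = fMix n d11 p1 u +
      ((-1 : ℝ) ^ n * (p1 : ℝ)) • ((∏ ℓ ∈ Finset.Icc 1 n, xv n ℓ) *
        ∏ ℓ ∈ Finset.Icc (u + 2) n, xv n ℓ) := by
  rw [prod_Icc_eq_mul_prod_mul_prod hu (by omega), fMix, fMix,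
    Finset.prod_Icc_succ_top (by omega), Finset.prod_Icc_succ_top (by omega),
    prod_Icc_eq_mul_prod hun, prod_Icc_eq_mul_prod hun, prod_Icc_eq_mul_prod hun]
  simp only [smul_eq_C_mul, Finset.prod_pow]
  ring

/-- The ideal generated by `fMix t`, the product of the variables and the `f^{d_i}_{i,2n−1−i}`. -/
def mixIdeal (n : ℕ) (d11 p1 : ℚ) (d : ℕ → ℕ → ℚ) (p : ℕ → ℚ) (t : ℕ) :
    Ideal (MvPolynomial (Fin n) ℝ) :=
  Ideal.span ({fMix n d11 p1 t, ∏ ℓ ∈ Finset.Icc 1 n, xv n ℓ} ∪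
    (fun i => fDd n d p i) '' Set.Icc 2 (n - 1))

theorem IDthj_eq_mixIdeal {n j : ℕ} (hn : 2 ≤ n) (hj : n ≤ j) (hj' : j ≤ 2 * n - 2) (d11 p1 : ℚ)
    (d : ℕ → ℕ → ℚ) (p : ℕ → ℚ) :
    IDthj n d11 p1 d p j = mixIdeal n d11 p1 d p (2 * n - 1 - j) := by
  rw [IDthj, mixIdeal, fD1_eq_fMix hn hj hj']

/-- The polynomials `f^{d_i}_{i,2n−1−i}` for `2 ≤ i ≤ n−1` as a list. -/
def fDdList (n : ℕ) (d : ℕ → ℕ → ℚ) (p : ℕ → ℚ) : List (MvPolynomial (Fin n) ℝ) :=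
  (Finset.Icc 2 (n - 1)).toList.map fun i => fDd n d p i

theorem mem_fDdList {n : ℕ} {d : ℕ → ℕ → ℚ} {p : ℕ → ℚ} {a : MvPolynomial (Fin n) ℝ} :
    a ∈ fDdList n d p ↔ a ∈ (fun i => fDd n d p i) '' Set.Icc 2 (n - 1) := by
  simp [fDdList]

theorem length_fDdList (n : ℕ) (d : ℕ → ℕ → ℚ) (p : ℕ → ℚ) :
    (fDdList n d p).length = n - 2 := by
  simp [fDdList]
  omega

theorem isHomogeneous_of_mem_image {n : ℕ} {d : ℕ → ℕ → ℚ} {p : ℕ → ℚ}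
    {a : MvPolynomial (Fin n) ℝ} (ha : a ∈ (fun i => fDd n d p i) '' Set.Icc 2 (n - 1)) :
    ∃ k ≠ 0, a.IsHomogeneous k := by
  obtain ⟨i, ⟨hi1, hi2⟩, rfl⟩ := ha
  exact ⟨_, by omega, isHomogeneous_fDd n d p (by omega)⟩

theorem mul_mem_mixIdeal_iff {n u : ℕ} (hu : 1 ≤ u) (hun : u + 1 ≤ n) (d11 p1 : ℚ)
    (d : ℕ → ℕ → ℚ) (p : ℕ → ℚ)
    [FiniteDimensional ℝ (MvPolynomial (Fin n) ℝ ⧸ mixIdeal n d11 p1 d p u)]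
    (a : MvPolynomial (Fin n) ℝ) :
    (xv n 1 + xv n (u + 1)) * a ∈ mixIdeal n d11 p1 d p u ↔
      a ∈ mixIdeal n d11 p1 d p (u + 1) := by
  set g := xv n 1 + xv n (u + 1) with hgdef
  set L := Ideal.span {a | a ∈ (∏ ℓ ∈ Finset.Icc 1 n, xv n ℓ) :: fDdList n d p} with hL
  have hK : ∀ t, mixIdeal n d11 p1 d p t = L ⊔ Ideal.span {fMix n d11 p1 t} := by
    intro t
    rw [mixIdeal, hL, ← Ideal.span_union]
    congr 1
    ext b
    simp only [Set.mem_union, Set.mem_insert_iff, Set.mem_singleton_iff, Set.mem_ofPred_eq,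
      List.mem_cons, mem_fDdList]
    tauto
  have hP : ∏ ℓ ∈ Finset.Icc 1 n, xv n ℓ ∈ L := Ideal.subset_span (by simp)
  have hmulF : g * fMix n d11 p1 (u + 1) - fMix n d11 p1 u ∈ L := by
    rw [hgdef, mul_fMix hu hun, add_sub_cancel_left, smul_eq_C_mul]
    exact L.mul_mem_left _ (L.mul_mem_right _ hP)
  have hhom : ∀ f ∈ ({fMix n d11 p1 u, ∏ ℓ ∈ Finset.Icc 1 n, xv n ℓ} ∪
      (fun i => fDd n d p i) '' Set.Icc 2 (n - 1) : Set (MvPolynomial (Fin n) ℝ)),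
      ∃ k, f.IsHomogeneous k := by
    rintro f ((rfl | rfl) | hf)
    · exact ⟨_, isHomogeneous_fMix n d11 p1 u⟩
    · exact ⟨_, isHomogeneous_prod_xv n⟩
    · obtain ⟨k, -, hk⟩ := isHomogeneous_of_mem_image hf
      exact ⟨k, hk⟩
  have hrad : RingHom.ker (constantCoeff : MvPolynomial (Fin n) ℝ →+* ℝ) ≤
      (mixIdeal n d11 p1 d p u).radical := by
    have : FiniteDimensional ℝ (MvPolynomial (Fin n) ℝ ⧸ Ideal.span
      ({fMix n d11 p1 u, ∏ ℓ ∈ Finset.Icc 1 n, xv n ℓ} ∪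
        (fun i => fDd n d p i) '' Set.Icc 2 (n - 1))) := ‹_›
    exact ker_constantCoeff_le_radical hhom
  have hFle : ∀ {I : Ideal (MvPolynomial (Fin n) ℝ)}, L ≤ I → g * fMix n d11 p1 (u + 1) ∈ I →
      mixIdeal n d11 p1 d p u ≤ I := by
    intro I hLI hFI
    rw [hK]
    refine sup_le hLI ((Ideal.span_singleton_le_iff_mem _).2 ?_)
    simpa using I.sub_mem hFI (hLI hmulF)
  have hle : mixIdeal n d11 p1 d p u ≤ mixIdeal n d11 p1 d p (u + 1) := by
    rw [hK (u + 1)]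
    exact hFle le_sup_left (Ideal.mul_mem_left _ _
      (Ideal.mem_sup_right (Ideal.mem_span_singleton_self _)))
  constructor
  · intro ha
    rw [hK, mem_sup_span_singleton_iff] at ha
    obtain ⟨c, hc⟩ := ha
    have hmem : g * (a - fMix n d11 p1 (u + 1) * c) ∈ L := by
      have := L.sub_mem hc (L.mul_mem_right c hmulF)
      convert this using 1
      ring
    have hg : constantCoeff g = 0 := constantCoeff_eq_zero_of_isHomogeneous
      ((isHomogeneous_xv n 1).add (isHomogeneous_xv n (u + 1))) one_ne_zero
    obtain ⟨s, hs, hsa⟩ := exists_mul_mem_span_of_mul_mem _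
      (by rw [List.length_cons, length_fDdList]; omega)
      (by
        intro b hb
        rcases List.mem_cons.1 hb with rfl | hb
        · exact constantCoeff_eq_zero_of_isHomogeneous (isHomogeneous_prod_xv n) (by omega)
        · obtain ⟨k, hk, hb⟩ := isHomogeneous_of_mem_image (mem_fDdList.1 hb)
          exact constantCoeff_eq_zero_of_isHomogeneous hb hk) hg
      (hrad.trans (Ideal.radical_mono (hFle le_sup_left (Ideal.mul_mem_right _ _
        (Ideal.mem_sup_right (Ideal.mem_span_singleton_self _)))))) hmem
    have hmem' : a - fMix n d11 p1 (u + 1) * c ∈ mixIdeal n d11 p1 d p (u + 1) := by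
      refine mem_of_mul_mem_of_ker_le_radical (hrad.trans (Ideal.radical_mono hle)) hs ?_
      rw [hK]
      exact Ideal.mem_sup_left hsa
    have hF : fMix n d11 p1 (u + 1) * c ∈ mixIdeal n d11 p1 d p (u + 1) :=
      Ideal.mul_mem_right _ _ (Ideal.subset_span (by simp))
    simpa using Ideal.add_mem _ hmem' hF
  · intro ha
    rw [hK, mem_sup_span_singleton_iff] at ha
    obtain ⟨c, hc⟩ := ha
    rw [hK, mem_sup_span_singleton_iff]
    refine ⟨c, ?_⟩
    have := L.add_mem (L.mul_mem_left g hc) (L.mul_mem_right c hmulF)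
    convert this using 1
    ring

theorem p1_ne_zero_of_finiteDimensional {n : ℕ} (hn : 2 ≤ n) {d11 p1 : ℚ} {d : ℕ → ℕ → ℚ}
    {p : ℕ → ℚ} [hfin : FiniteDimensional ℝ (MvPolynomial (Fin n) ℝ ⧸ IDhj n d11 p1 d p n)] :
    p1 ≠ 0 := by
  rintro rfl
  obtain ⟨u, rfl⟩ : ∃ u, n = u + 1 := ⟨n - 1, by omega⟩
  have hcc : ∀ b ∈ fMix (u + 1) d11 0 (u + 1) :: fDdList (u + 1) d p,
      ∃ k ≠ 0, b.IsHomogeneous k := by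
    intro b hb
    rcases List.mem_cons.1 hb with rfl | hb
    · exact ⟨_, by omega, isHomogeneous_fMix _ _ _ _⟩
    · exact isHomogeneous_of_mem_image (mem_fDdList.1 hb)
  have hspan : IDhj (u + 1) d11 0 d p (u + 1) =
      Ideal.span {a | a ∈ fMix (u + 1) d11 0 (u + 1) :: fDdList (u + 1) d p} := by
    rw [IDhj, fDnLast_eq_fMix, fD1_eq_fMix hn le_rfl (by omega),
      show 2 * (u + 1) - 1 - (u + 1) = u by omega]
    have hmul := mul_fMix (n := u + 1) (u := u) (by omega) le_rfl d11 0
    simp only [Rat.cast_zero, mul_zero, zero_smul, add_zero] at hmul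
    apply le_antisymm
    · rw [Ideal.span_le]
      rintro b ((rfl | rfl) | hb)
      · rw [← hmul]
        exact Ideal.mul_mem_left _ _ (Ideal.subset_span (by simp))
      · exact Ideal.subset_span (by simp)
      · exact Ideal.subset_span (List.mem_cons_of_mem _ (mem_fDdList.2 hb))
    · refine Ideal.span_mono ?_
      intro b hb
      rcases List.mem_cons.1 hb with rfl | hb
      · simp
      · exact Or.inr (mem_fDdList.1 hb)
  rw [hspan] at hfin
  have hrad := ker_constantCoeff_le_radical
    (s := {a | a ∈ fMix (u + 1) d11 0 (u + 1) :: fDdList (u + 1) d p}) (fun f hf => by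
    obtain ⟨k, -, hk⟩ := hcc f hf
    exact ⟨k, hk⟩)
  obtain ⟨s, hs, hsa⟩ := exists_mul_mem_span_of_mul_mem (a := 1) (g := 0)
    (fMix (u + 1) d11 0 (u + 1) :: fDdList (u + 1) d p)
    (by rw [List.length_cons, length_fDdList]; omega)
    (by
      intro b hb
      obtain ⟨k, hk, hb⟩ := hcc b hb
      exact constantCoeff_eq_zero_of_isHomogeneous hb hk)
    (map_zero _) (hrad.trans (Ideal.radical_mono le_sup_left)) (by simp)
  have hle : Ideal.span {a | a ∈ fMix (u + 1) d11 0 (u + 1) :: fDdList (u + 1) d p} ≤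
      RingHom.ker (constantCoeff : MvPolynomial (Fin (u + 1)) ℝ →+* ℝ) := by
    rw [Ideal.span_le]
    intro b hb
    obtain ⟨k, hk, hb⟩ := hcc b hb
    exact constantCoeff_eq_zero_of_isHomogeneous hb hk
  exact hs (by simpa using hle hsa)

theorem IDhj_eq_mixIdeal {n : ℕ} (hn : 2 ≤ n) {d11 p1 : ℚ} (hp1 : p1 ≠ 0) (d : ℕ → ℕ → ℚ)
    (p : ℕ → ℚ) : IDhj n d11 p1 d p n = mixIdeal n d11 p1 d p n := by
  obtain ⟨u, rfl⟩ : ∃ u, n = u + 1 := ⟨n - 1, by omega⟩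
  have hmul := mul_fMix (n := u + 1) (u := u) (by omega) le_rfl d11 p1
  rw [Finset.Icc_eq_empty (a := u + 2) (by omega), Finset.prod_empty, mul_one] at hmul
  rw [IDhj, mixIdeal, fDnLast_eq_fMix, fD1_eq_fMix hn le_rfl (by omega),
    show 2 * (u + 1) - 1 - (u + 1) = u by omega]
  apply le_antisymm <;> rw [Ideal.span_le] <;> rintro b ((rfl | rfl) | hb)
  · rw [SetLike.mem_coe, eq_sub_iff_add_eq.2 hmul.symm, smul_eq_C_mul]
    exact Ideal.sub_mem _ (Ideal.mul_mem_left _ _ (Ideal.subset_span (by simp)))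
      (Ideal.mul_mem_left _ _ (Ideal.subset_span (by simp)))
  · exact Ideal.subset_span (by simp)
  · exact Ideal.subset_span (Or.inr hb)
  · exact Ideal.subset_span (by simp)
  · have hc : ((-1 : ℝ) ^ (u + 1) * (p1 : ℝ)) ≠ 0 :=
      mul_ne_zero (pow_ne_zero _ (by norm_num)) (by exact_mod_cast hp1)
    rw [← sub_eq_iff_eq_add'] at hmul
    rw [SetLike.mem_coe, ← inv_smul_smul₀ hc (∏ ℓ ∈ Finset.Icc 1 (u + 1), xv (u + 1) ℓ), ← hmul,
      smul_eq_C_mul]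
    exact Ideal.mul_mem_left _ _ (Ideal.sub_mem _ (Ideal.mul_mem_left _ _
      (Ideal.subset_span (by simp))) (Ideal.subset_span (by simp)))
  · exact Ideal.subset_span (Or.inr hb)

end Generators

section Cokernel

theorem prod_Icc_succ_succ {M : Type*} [CommMonoid M] (a b : ℕ) (f : ℕ → M) :
    ∏ ℓ ∈ Finset.Icc (a + 1) (b + 1), f ℓ = ∏ ℓ ∈ Finset.Icc a b, f (ℓ + 1) := by
  rw [← Finset.map_add_right_Icc a b 1, Finset.prod_map]
  rfl

theorem sum_Icc_succ_succ {M : Type*} [AddCommMonoid M] (a b : ℕ) (f : ℕ → M) :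
    ∑ ℓ ∈ Finset.Icc (a + 1) (b + 1), f ℓ = ∑ ℓ ∈ Finset.Icc a b, f (ℓ + 1) := by
  rw [← Finset.map_add_right_Icc a b 1, Finset.sum_map]
  rfl

/-- The substitution `x_1 ↦ -x_{u+1}`, with the remaining variables `x_2,…,x_{m+1}` renumbered
from `1` to `m`. -/
def substFirst (m u : ℕ) : MvPolynomial (Fin (m + 1)) ℝ →ₐ[ℝ] MvPolynomial (Fin m) ℝ :=
  aeval (Fin.cases (-xv m u) fun i => X i)

theorem substFirst_xv_one (m u : ℕ) : substFirst m u (xv (m + 1) 1) = -xv m u := by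
  rw [xv, dif_pos ⟨le_rfl, by omega⟩, substFirst, aeval_X]
  rfl

theorem substFirst_xv_succ (m u : ℕ) {k : ℕ} (hk : 1 ≤ k) :
    substFirst m u (xv (m + 1) (k + 1)) = xv m k := by
  by_cases hkm : k ≤ m
  · have hX : xv m k = X ⟨k - 1, by omega⟩ := dif_pos ⟨hk, hkm⟩
    rw [hX, xv, dif_pos ⟨by omega, by omega⟩, substFirst, aeval_X]
    have : (⟨k + 1 - 1, by omega⟩ : Fin (m + 1)) = Fin.succ ⟨k - 1, by omega⟩ := by
      ext
      simp
      omega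
    rw [this, Fin.cases_succ]
  · rw [xv, dif_neg (by omega), xv, dif_neg (by omega), map_zero]

theorem substFirst_rename_succ (m u : ℕ) (q : MvPolynomial (Fin m) ℝ) :
    substFirst m u (rename Fin.succ q) = q := by
  rw [substFirst, aeval_rename]
  exact aeval_X_left_apply q

theorem sub_rename_substFirst_mem {m u : ℕ} (hu : 1 ≤ u) (hum : u ≤ m)
    (q : MvPolynomial (Fin (m + 1)) ℝ) :
    q - rename Fin.succ (substFirst m u q) ∈
      Ideal.span {xv (m + 1) 1 + xv (m + 1) (u + 1)} := by
  set I := Ideal.span {xv (m + 1) 1 + xv (m + 1) (u + 1)}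
  suffices h : Ideal.Quotient.mkₐ ℝ I =
      ((Ideal.Quotient.mkₐ ℝ I).comp (rename Fin.succ)).comp (substFirst m u) from
    Ideal.Quotient.eq.1 (DFunLike.congr_fun h q)
  refine algHom_ext fun i => ?_
  refine Ideal.Quotient.eq.2 ?_
  refine Fin.cases ?_ (fun i => ?_) i
  · have hX : (X 0 : MvPolynomial (Fin (m + 1)) ℝ) = xv (m + 1) 1 := by
      rw [xv, dif_pos ⟨le_rfl, by omega⟩]
      rfl
    have hXu : rename Fin.succ (xv m u) = xv (m + 1) (u + 1) := by
      rw [xv, dif_pos ⟨hu, hum⟩, rename_X, xv, dif_pos ⟨by omega, by omega⟩]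
      congr 1
      ext
      simp
      omega
    rw [hX]
    show xv (m + 1) 1 - rename Fin.succ (substFirst m u (xv (m + 1) 1)) ∈ I
    rw [substFirst_xv_one, map_neg, sub_neg_eq_add, hXu]
    exact Ideal.mem_span_singleton_self _
  · have : substFirst m u (X i.succ) = X i := by rw [substFirst, aeval_X, Fin.cases_succ]
    show X i.succ - rename Fin.succ (substFirst m u (X i.succ)) ∈ I
    rw [this, rename_X, sub_self]
    exact I.zero_mem

theorem substFirst_prod_xv_succ (m u a : ℕ) (ha : 1 ≤ a) :
    substFirst m u (∏ ℓ ∈ Finset.Icc (a + 1) (m + 1), xv (m + 1) ℓ) =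
      ∏ ℓ ∈ Finset.Icc a m, xv m ℓ := by
  rw [prod_Icc_succ_succ, map_prod]
  exact Finset.prod_congr rfl fun l hl =>
    substFirst_xv_succ m u (ha.trans (Finset.mem_Icc.1 hl).1)

theorem substFirst_prod_xv (m u : ℕ) :
    substFirst m u (∏ ℓ ∈ Finset.Icc 1 (m + 1), xv (m + 1) ℓ) =
      -((∏ ℓ ∈ Finset.Icc 1 m, xv m ℓ) * xv m u) := by
  rw [prod_Icc_eq_mul_prod (by omega), map_mul, substFirst_xv_one,
    substFirst_prod_xv_succ m u 1 le_rfl]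
  ring

theorem substFirst_fMix_mem {m u : ℕ} (hu : 1 ≤ u) (hum : u ≤ m) (d11 p1 : ℚ) :
    substFirst m u (fMix (m + 1) d11 p1 u) ∈
      Ideal.span {(∏ ℓ ∈ Finset.Icc 1 m, xv m ℓ) * xv m u} := by
  have h := congrArg (substFirst m u) (mul_fMix (n := m + 1) hu (by omega) d11 p1)
  rw [map_mul, map_add, map_add, substFirst_xv_one, substFirst_xv_succ m u hu, neg_add_cancel,
    zero_mul, map_smul, map_mul, substFirst_prod_xv] at h
  rw [eq_neg_of_add_eq_zero_left h.symm, smul_eq_C_mul]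
  exact neg_mem (Ideal.mul_mem_left _ _ (Ideal.mul_mem_right _ _
    (neg_mem (Ideal.mem_span_singleton_self _))))

/-- The coefficients obtained from `d` by the substitution `x_1 ↦ -x_{u+1}`. -/
def substCoeff (d : ℕ → ℕ → ℚ) (u : ℕ) (i k : ℕ) : ℚ :=
  d (i + 1) (k + 1) + if k = u then d (i + 1) 1 else 0

theorem substFirst_fDd {m u i : ℕ} (hu : 1 ≤ u) (hum : u ≤ m) (hi : 1 ≤ i) (d : ℕ → ℕ → ℚ)
    (p : ℕ → ℚ) :
    substFirst m u (fDd (m + 1) d p (i + 1)) =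
      fDd m (substCoeff d u) (fun i => p (i + 1)) i := by
  rw [fDd, if_neg (by omega), fDd, if_neg (by omega), map_add, map_smul, map_sum,
    Nat.add_sub_add_right]
  congr 1
  · have hterm : ∀ k, 1 ≤ k → substFirst m u ((d (i + 1) (k + 1) : ℝ) •
        ∏ ℓ ∈ Finset.Icc (i + 1 + 1) (m + 1), (xv (m + 1) (k + 1) ^ 2 - xv (m + 1) ℓ ^ 2)) =
        (d (i + 1) (k + 1) : ℝ) • ∏ ℓ ∈ Finset.Icc (i + 1) m, (xv m k ^ 2 - xv m ℓ ^ 2) := by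
      intro k hk
      rw [prod_Icc_succ_succ, map_smul, map_prod]
      congr 1
      refine Finset.prod_congr rfl fun l hl => ?_
      rw [map_sub, map_pow, map_pow, substFirst_xv_succ m u hk,
        substFirst_xv_succ m u (by have := (Finset.mem_Icc.1 hl).1; omega)]
    have hfirst : substFirst m u ((d (i + 1) 1 : ℝ) •
        ∏ ℓ ∈ Finset.Icc (i + 1 + 1) (m + 1), (xv (m + 1) 1 ^ 2 - xv (m + 1) ℓ ^ 2)) =
        (d (i + 1) 1 : ℝ) • ∏ ℓ ∈ Finset.Icc (i + 1) m, (xv m u ^ 2 - xv m ℓ ^ 2) := by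
      rw [prod_Icc_succ_succ, map_smul, map_prod]
      congr 1
      refine Finset.prod_congr rfl fun l hl => ?_
      rw [map_sub, map_pow, map_pow, substFirst_xv_one, neg_sq,
        substFirst_xv_succ m u (by have := (Finset.mem_Icc.1 hl).1; omega)]
    rw [← Finset.add_sum_Ioc_eq_sum_Icc (by omega), ← Finset.Icc_add_one_left_eq_Ioc,
      sum_Icc_succ_succ, hfirst, Finset.sum_congr rfl fun k hk =>
        hterm k (Finset.mem_Icc.1 hk).1]
    simp only [substCoeff, Rat.cast_add, add_smul, Finset.sum_add_distrib]
    rw [add_comm]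
    congr 1
    simp only [apply_ite (Rat.cast : ℚ → ℝ), Rat.cast_zero, ite_smul, zero_smul,
      Finset.sum_ite_eq', Finset.mem_Icc]
    split_ifs with h
    · rfl
    · rw [Finset.prod_eq_zero (i := u) (Finset.mem_Icc.2 ⟨by omega, hum⟩) (sub_self _), smul_zero]
  · rw [prod_Icc_succ_succ, map_prod]
    congr 1
    refine Finset.prod_congr rfl fun l hl => ?_
    rw [map_pow, substFirst_xv_succ m u (by have := (Finset.mem_Icc.1 hl).1; omega)]

theorem map_substFirst_mixIdeal {m u : ℕ} (hu : 1 ≤ u) (hum : u ≤ m) (d11 p1 : ℚ)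
    (d : ℕ → ℕ → ℚ) (p : ℕ → ℚ) :
    (mixIdeal (m + 1) d11 p1 d p u).map (substFirst m u) =
      IDnj' m (substCoeff d u) (fun i => p (i + 1)) u := by
  apply le_antisymm
  · rw [mixIdeal, Ideal.map_le_iff_le_comap, Ideal.span_le]
    rintro b ((rfl | rfl) | ⟨i, ⟨hi1, hi2⟩, rfl⟩)
    · exact Ideal.span_mono (by simp) (substFirst_fMix_mem hu hum d11 p1)
    · rw [SetLike.mem_coe, Ideal.mem_comap, substFirst_prod_xv]
      exact neg_mem (Ideal.subset_span (by simp))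
    · obtain ⟨i, rfl⟩ : ∃ k, i = k + 1 := ⟨i - 1, by omega⟩
      rw [SetLike.mem_coe, Ideal.mem_comap, substFirst_fDd hu hum (by omega)]
      exact Ideal.subset_span (Or.inr ⟨i, ⟨by omega, by omega⟩, rfl⟩)
  · rw [IDnj', Ideal.span_le]
    rintro b (rfl | ⟨i, ⟨hi1, hi2⟩, rfl⟩)
    · rw [SetLike.mem_coe, ← neg_neg (_ * _), ← substFirst_prod_xv]
      exact neg_mem (Ideal.mem_map_of_mem _ (Ideal.subset_span (by simp)))
    · show fDd m (substCoeff d u) (fun i => p (i + 1)) i ∈ _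
      rw [← substFirst_fDd hu hum hi1]
      exact Ideal.mem_map_of_mem _
        (Ideal.subset_span (Or.inr ⟨i + 1, ⟨by omega, by omega⟩, rfl⟩))

theorem exists_mixIdeal_exact_sequence {n t : ℕ} (ht : 2 ≤ t) (htn : t ≤ n) {d11 p1 : ℚ}
    {d : ℕ → ℕ → ℚ} {p : ℕ → ℚ} {I I' : Ideal (MvPolynomial (Fin n) ℝ)}
    (hI : I = mixIdeal n d11 p1 d p t) (hI' : I' = mixIdeal n d11 p1 d p (t - 1))
    (hfin : FiniteDimensional ℝ (MvPolynomial (Fin n) ℝ ⧸ I')) :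
    ∃ (d' : ℕ → ℕ → ℚ) (p' : ℕ → ℚ)
      (φ : (MvPolynomial (Fin n) ℝ ⧸ I) →ₗ[ℝ] (MvPolynomial (Fin n) ℝ ⧸ I'))
      (ψ : (MvPolynomial (Fin n) ℝ ⧸ I') →ₐ[ℝ]
        (MvPolynomial (Fin (n - 1)) ℝ ⧸ IDnj' (n - 1) d' p' (t - 1))),
      (∀ f : MvPolynomial (Fin n) ℝ, φ (Ideal.Quotient.mk I f) =
        Ideal.Quotient.mk I' ((xv n 1 + xv n t) * f)) ∧
      Function.Injective φ ∧ Function.Surjective ψ ∧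
      LinearMap.range φ = LinearMap.ker ψ.toLinearMap := by
  obtain ⟨m, rfl⟩ : ∃ m, n = m + 1 := ⟨n - 1, by omega⟩
  obtain ⟨u, rfl⟩ : ∃ u, t = u + 1 := ⟨t - 1, by omega⟩
  rw [Nat.add_sub_cancel] at hI'
  subst hI hI'
  have hu : 1 ≤ u := by omega
  have hum : u ≤ m := by omega
  refine ⟨substCoeff d u, fun i => p (i + 1), exists_mul_exact_sequence (substFirst m u)
    (fun q => ⟨rename Fin.succ q, substFirst_rename_succ m u q⟩) ?_ (fun q hq => ?_)
    (mul_mem_mixIdeal_iff hu htn d11 p1 d p) (map_substFirst_mixIdeal hu hum d11 p1 d p)⟩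
  · rw [map_add, substFirst_xv_one, substFirst_xv_succ m u hu, neg_add_cancel]
  · have := sub_rename_substFirst_mem hu hum q
    rwa [hq, map_zero, sub_zero] at this

end Cokernel

/-- **The exact sequences (5.31) and (5.32).** Assume `R^{D}_{h_n}` and the
`R^{D}_{h̃_j}` (`n ≤ j ≤ 2n−2`) are Artinian. Then (b) multiplication by `x_1+x_n`
induces a well-defined injective ℝ-linear map `R^{D}_{h_n} → R^{D}_{h̃_n}` with cokernel
isomorphic to a ring `R^{D'_{(n−1)}}(n−1)`, and (c) for `n+1 ≤ j ≤ 2n−2`, multiplication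
by `x_1+x_{2n−j}` induces a well-defined injective ℝ-linear map
`R^{D}_{h̃_{j−1}} → R^{D}_{h̃_j}` with cokernel isomorphic to a ring
`R^{D'_{(n−1)}}(2n−j−1)`. -/
theorem stmt_14 (n : ℕ) (hn : 2 ≤ n) (d11 p1 : ℚ) (d : ℕ → ℕ → ℚ) (p : ℕ → ℚ)
    (hart0 : FiniteDimensional ℝ (MvPolynomial (Fin n) ℝ ⧸ IDhj n d11 p1 d p n))
    (hart : ∀ j ∈ Finset.Icc n (2 * n - 2),
      FiniteDimensional ℝ (MvPolynomial (Fin n) ℝ ⧸ IDthj n d11 p1 d p j)) :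
    (∃ (d' : ℕ → ℕ → ℚ) (p' : ℕ → ℚ),
      ∃ (φ : (MvPolynomial (Fin n) ℝ ⧸ IDhj n d11 p1 d p n) →ₗ[ℝ]
            (MvPolynomial (Fin n) ℝ ⧸ IDthj n d11 p1 d p n))
        (ψ : (MvPolynomial (Fin n) ℝ ⧸ IDthj n d11 p1 d p n) →ₐ[ℝ]
            (MvPolynomial (Fin (n - 1)) ℝ ⧸ IDnj' (n - 1) d' p' (n - 1))),
        (∀ f : MvPolynomial (Fin n) ℝ,
          φ (Ideal.Quotient.mk (IDhj n d11 p1 d p n) f) =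
            Ideal.Quotient.mk (IDthj n d11 p1 d p n) ((xv n 1 + xv n n) * f)) ∧
        Function.Injective φ ∧ Function.Surjective ψ ∧
        LinearMap.range φ = LinearMap.ker ψ.toLinearMap) ∧
    (∀ j, n + 1 ≤ j → j ≤ 2 * n - 2 →
      ∃ (d' : ℕ → ℕ → ℚ) (p' : ℕ → ℚ),
      ∃ (φ : (MvPolynomial (Fin n) ℝ ⧸ IDthj n d11 p1 d p (j - 1)) →ₗ[ℝ]
            (MvPolynomial (Fin n) ℝ ⧸ IDthj n d11 p1 d p j))
        (ψ : (MvPolynomial (Fin n) ℝ ⧸ IDthj n d11 p1 d p j) →ₐ[ℝ]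
            (MvPolynomial (Fin (n - 1)) ℝ ⧸ IDnj' (n - 1) d' p' (2 * n - j - 1))),
        (∀ f : MvPolynomial (Fin n) ℝ,
          φ (Ideal.Quotient.mk (IDthj n d11 p1 d p (j - 1)) f) =
            Ideal.Quotient.mk (IDthj n d11 p1 d p j) ((xv n 1 + xv n (2 * n - j)) * f)) ∧
        Function.Injective φ ∧ Function.Surjective ψ ∧
        LinearMap.range φ = LinearMap.ker ψ.toLinearMap) := by
  have hp1 : p1 ≠ 0 := p1_ne_zero_of_finiteDimensional hn (hfin := hart0)
  refine ⟨?_, fun j hj hj' => ?_⟩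
  · refine exists_mixIdeal_exact_sequence hn le_rfl (IDhj_eq_mixIdeal hn hp1 d p) ?_
      (hart n (Finset.mem_Icc.2 ⟨le_rfl, by omega⟩))
    rw [IDthj_eq_mixIdeal hn le_rfl (by omega)]
    congr 1
    omega
  · refine exists_mixIdeal_exact_sequence (d11 := d11) (p1 := p1) (d := d) (p := p)
      (t := 2 * n - j) (by omega) (by omega) ?_ ?_
      (hart j (Finset.mem_Icc.2 ⟨by omega, hj'⟩))
    · rw [IDthj_eq_mixIdeal hn (by omega) (by omega)]
      congr 1
      omega
    · rw [IDthj_eq_mixIdeal hn (by omega) hj']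
      congr 1
      omega
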